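/- arXiv:1008.4024 — 8 statements merged into one kernel-verified Lean document; each statement's English description precedes it below -/
import Mathlib

section
/- Let S be an abstract Cu-semigroup, let e ∈ S be full, let r > 0 be a real number, and suppose x, y ∈ S satisfy λ(x) + r·λ(e) ≤ λ(y) for all λ ∈ F(S). Then y is full, i.e., sup_n n·y is the greatest element of S. -/
open scoped ENNReal

/-- Compact containment relation: `x ≪ y`. -/
def CuWayBelow {S : Type*} [Preorder S] (x y : S) : Prop :=
  ∀ f : ℕ → S, Monotone f → IsLUB (Set.range f) y → ∃ n, x ≤ f n

/-- An abstract Cu-semigroup. -/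
class CuSemigroup (S : Type*) extends AddCommMonoid S, PartialOrder S where
  zero_le (x : S) : 0 ≤ x
  add_le_add {x₁ x₂ y₁ y₂ : S} : x₁ ≤ y₁ → x₂ ≤ y₂ → x₁ + x₂ ≤ y₁ + y₂
  exists_sup (f : ℕ → S) : Monotone f → ∃ s, IsLUB (Set.range f) s
  exists_rapid (x : S) : ∃ f : ℕ → S,
    (∀ n, CuWayBelow (f n) (f (n + 1))) ∧ IsLUB (Set.range f) x
  wayBelow_directed_le (x : S) : DirectedOn (· ≤ ·) {z : S | CuWayBelow z x}
  wayBelow_directed_wb (x : S) : DirectedOn CuWayBelow {z : S | CuWayBelow z x}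
  add_wayBelow {x₁ x₂ y₁ y₂ : S} :
    CuWayBelow x₁ y₁ → CuWayBelow x₂ y₂ → CuWayBelow (x₁ + x₂) (y₁ + y₂)
  add_isLUB {f g : ℕ → S} {a b : S} : Monotone f → Monotone g →
    IsLUB (Set.range f) a → IsLUB (Set.range g) b →
    IsLUB (Set.range fun n => f n + g n) (a + b)

/-- A functional on a Cu-semigroup. -/
structure IsCuFunctional {S : Type*} [CuSemigroup S] (lam : S → ℝ≥0∞) : Prop where
  map_zero : lam 0 = 0
  map_add : ∀ x y : S, lam (x + y) = lam x + lam y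
  mono : Monotone lam
  map_sup : ∀ (f : ℕ → S) (s : S), Monotone f → IsLUB (Set.range f) s →
    lam s = ⨆ n, lam (f n)

/-- `e` is full: the supremum of `n • e` is the greatest element. -/
def CuFull {S : Type*} [CuSemigroup S] (e : S) : Prop :=
  ∀ w : S, IsLUB (Set.range fun n : ℕ => n • e) w → ∀ x : S, x ≤ w

/-- Condition (R1) for `(S, e)` and `r`. -/
def CuR1 {S : Type*} [CuSemigroup S] (e : S) (r : ℝ) : Prop :=
  ∀ x y : S,
    (∀ lam : S → ℝ≥0∞, IsCuFunctional lam →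
      lam x + ENNReal.ofReal r * lam e ≤ lam y) → x ≤ y

/-- Condition (R2) for `(S, e)` and `r`. -/
def CuR2 {S : Type*} [CuSemigroup S] (e : S) (r : ℝ) : Prop :=
  ∀ x y : S,
    (∃ n m : ℕ, 0 < n ∧ 0 < m ∧ r < (m : ℝ) / (n : ℝ) ∧
      (n + 1) • x + m • e ≤ n • y) → x ≤ y

/-- Condition (R2') for `(S, e)` and `r`. -/
def CuR2' {S : Type*} [CuSemigroup S] (e : S) (r : ℝ) : Prop :=
  ∀ x y : S,
    (∀ x' e' : S, CuWayBelow x' x → CuWayBelow e' e →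
      ∃ n m : ℕ, 0 < n ∧ 0 < m ∧ r < (m : ℝ) / (n : ℝ) ∧
        (n + 1) • x' + m • e' ≤ n • y) → x ≤ y

/-- The radius of comparison of `(S, e)`. -/
noncomputable def cuRadius {S : Type*} [CuSemigroup S] (e : S) : ℝ≥0∞ :=
  sInf {t : ℝ≥0∞ | ∃ r : ℝ, 0 < r ∧ CuR1 e r ∧ t = ENNReal.ofReal r}

theorem CuSemigroup.monotone_nsmul {S : Type*} [CuSemigroup S] (y : S) :
    Monotone fun n : ℕ => n • y := by
  refine monotone_nat_of_le_succ fun n => ?_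
  rw [succ_nsmul]
  simpa using CuSemigroup.add_le_add (le_refl (n • y)) (CuSemigroup.zero_le y)

theorem CuSemigroup.add_self_le_of_isLUB_nsmul {S : Type*} [CuSemigroup S] {y w : S}
    (hw : IsLUB (Set.range fun n : ℕ => n • y) w) : w + w ≤ w := by
  have hy := CuSemigroup.monotone_nsmul y
  refine (CuSemigroup.add_isLUB hy hy hw hw).2 ?_
  rintro _ ⟨n, rfl⟩
  exact hw.1 ⟨n + n, add_nsmul y n n⟩

theorem CuSemigroup.nsmul_le_of_add_self_le {S : Type*} [CuSemigroup S] {e w : S}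
    (hw : w + w ≤ w) (he : e ≤ w) (n : ℕ) : n • e ≤ w := by
  induction n with
  | zero => simpa using CuSemigroup.zero_le w
  | succ n ih =>
    rw [succ_nsmul]
    exact (CuSemigroup.add_le_add ih he).trans hw

open Classical in
/-- The functional attached to the ideal generated by an idempotent `w`: it vanishes on the
elements below `w` and is infinite elsewhere. -/
theorem isCuFunctional_ite_le {S : Type*} [CuSemigroup S] {w : S} (hw : w + w ≤ w) :
    IsCuFunctional fun z : S => if z ≤ w then (0 : ℝ≥0∞) else ∞ where
  map_zero := if_pos (CuSemigroup.zero_le w)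
  map_add a b := by
    have hab : a + b ≤ w ↔ a ≤ w ∧ b ≤ w := by
      refine ⟨fun h => ⟨?_, ?_⟩, fun h => (CuSemigroup.add_le_add h.1 h.2).trans hw⟩
      · simpa using (CuSemigroup.add_le_add (le_refl a) (CuSemigroup.zero_le b)).trans h
      · simpa using (CuSemigroup.add_le_add (CuSemigroup.zero_le a) (le_refl b)).trans h
    by_cases ha : a ≤ w <;> by_cases hb : b ≤ w <;> simp [hab, ha, hb]
  mono a b hab := by
    by_cases hb : b ≤ w
    · simp [hb, hab.trans hb]
    · simp [hb]
  map_sup f s _ hs := by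
    by_cases hsw : s ≤ w
    · have hf n : f n ≤ w := (hs.1 ⟨n, rfl⟩).trans hsw
      simp [hsw, hf]
    · obtain ⟨n, hn⟩ : ∃ n, ¬ f n ≤ w := by
        by_contra! hf
        exact hsw (hs.2 (Set.forall_mem_range.2 hf))
      simp only [hsw, if_false]
      refine (top_le_iff.1 ?_).symm
      exact (if_neg hn).ge.trans (le_iSup (fun n => if f n ≤ w then (0 : ℝ≥0∞) else ∞) n)

/-- If λ(x) + r·λ(e) ≤ λ(y) for all functionals λ, with e full, then y is full. -/
theorem cu_full_of_functional_ineq {S : Type*} [CuSemigroup S] (e : S)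
    (hfull : CuFull e) (r : ℝ) (hr : 0 < r) (x y : S)
    (h : ∀ lam : S → ℝ≥0∞, IsCuFunctional lam →
      lam x + ENNReal.ofReal r * lam e ≤ lam y) :
    CuFull y := by
  classical
  intro w hw z
  have hww := CuSemigroup.add_self_le_of_isLUB_nsmul hw
  have hyw : y ≤ w := hw.1 ⟨1, one_nsmul y⟩
  have hew : e ≤ w := by
    by_contra hew
    simpa [hyw, hew, hr] using h _ (isCuFunctional_ite_le hww)
  obtain ⟨v, hv⟩ := CuSemigroup.exists_sup _ (CuSemigroup.monotone_nsmul e)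
  exact (hfull v hv z).trans
    (hv.2 (Set.forall_mem_range.2 (CuSemigroup.nsmul_le_of_add_self_le hww hew)))
end

section
/- Let S and T be abstract Cu-semigroups and let π : S → T be a surjective map that is additive, order preserving, maps 0 to 0, preserves suprema of increasing sequences, and preserves the relation ≪. Suppose z ∈ S satisfies π(z) = 0 and that for all u, v ∈ S, π(u) ≤ π(v) implies u ≤ v + z. Let e ∈ S be full. Then π(e) is full in T, every r > 0 satisfying condition (R2') for (S, e) also satisfies condition (R2') for (T, π(e)), and consequently r_{(T,π(e))} ≤ r_{(S,e)}. (This is the order-semigroup content of the statement that the radius of comparison does not increase under passage to quotients: for a C*-algebra A with closed two-sided ideal I, taking S = Cu(A), T = Cu(A/I), π the map induced by the quotient map, and z the largest element of Cu(I), one obtains r_{A/I,π(a)} ≤ r_{A,a} for a full positive element a.) -/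
open scoped ENNReal

/-- A morphism in the category Cu. -/
structure IsCuMorphism {S T : Type*} [CuSemigroup S] [CuSemigroup T] (π : S → T) : Prop where
  map_zero : π 0 = 0
  map_add : ∀ x y : S, π (x + y) = π x + π y
  mono : Monotone π
  map_sup : ∀ (f : ℕ → S) (s : S), Monotone f → IsLUB (Set.range f) s →
    IsLUB (Set.range fun n => π (f n)) (π s)
  map_wayBelow : ∀ x y : S, CuWayBelow x y → CuWayBelow (π x) (π y)

section CuQuotient

variable {S T : Type*} [CuSemigroup S] [CuSemigroup T] {π : S → T}

theorem IsCuMorphism.map_nsmul (hπ : IsCuMorphism π) (n : ℕ) (x : S) :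
    π (n • x) = n • π x := by
  induction n with
  | zero => simp [hπ.map_zero]
  | succ k ih => rw [succ_nsmul, succ_nsmul, hπ.map_add, ih]

theorem CuSemigroup.le_add_right (x y : S) : x ≤ x + y := by
  simpa using CuSemigroup.add_le_add (le_refl x) (CuSemigroup.zero_le y)

theorem CuSemigroup.monotone_nsmul_right (e : S) : Monotone fun n : ℕ => n • e :=
  monotone_nat_of_le_succ fun n => by
    simpa only [succ_nsmul] using CuSemigroup.le_add_right (n • e) e

theorem CuSemigroup.le_nsmul {n : ℕ} (hn : 0 < n) (x : S) : x ≤ n • x := by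
  simpa using CuSemigroup.monotone_nsmul_right x hn

theorem CuFull.map (hπ : IsCuMorphism π) (hsurj : Function.Surjective π) {e : S}
    (he : CuFull e) : CuFull (π e) := by
  intro w hw x
  obtain ⟨u, rfl⟩ := hsurj x
  obtain ⟨s, hs⟩ := CuSemigroup.exists_sup _ (CuSemigroup.monotone_nsmul_right e)
  have h := hπ.map_sup _ s (CuSemigroup.monotone_nsmul_right e) hs
  simp only [hπ.map_nsmul] at h
  rw [hw.unique h]
  exact hπ.mono (he s hs u)

theorem CuR2'.map (hπ : IsCuMorphism π) (hsurj : Function.Surjective π)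
    {z : S} (hz : π z = 0) (hquot : ∀ u v : S, π u ≤ π v → u ≤ v + z)
    {e : S} {r : ℝ} (h : CuR2' e r) : CuR2' (π e) r := by
  intro x y hxy
  obtain ⟨u, rfl⟩ := hsurj x
  obtain ⟨v, rfl⟩ := hsurj y
  have huv : u ≤ v + z := by
    refine h u (v + z) fun u' e' hu' he' => ?_
    obtain ⟨n, m, hn, hm, hr, hle⟩ :=
      hxy _ _ (hπ.map_wayBelow _ _ hu') (hπ.map_wayBelow _ _ he')
    refine ⟨n, m, hn, hm, hr, ?_⟩
    simp only [← hπ.map_nsmul, ← hπ.map_add] at hle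
    refine (hquot _ _ hle).trans ?_
    rw [nsmul_add]
    exact CuSemigroup.add_le_add le_rfl (CuSemigroup.le_nsmul hn z)
  simpa [hπ.map_add, hz] using hπ.mono huv

/-- A functional vanishing on `z` descends along a quotient map with kernel generated by `z`. -/
theorem IsCuFunctional.exists_descend (hπ : IsCuMorphism π) (hsurj : Function.Surjective π)
    {z : S} (hz : π z = 0) (hquot : ∀ u v : S, π u ≤ π v → u ≤ v + z)
    {lam : S → ℝ≥0∞} (hlam : IsCuFunctional lam) (hlz : lam z = 0) :
    ∃ mu : T → ℝ≥0∞, IsCuFunctional mu ∧ ∀ u, mu (π u) = lam u := by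
  have hle : ∀ u v, π u ≤ π v → lam u ≤ lam v := fun u v huv => by
    simpa [hlam.map_add, hlz] using hlam.mono (hquot u v huv)
  choose g hg using hsurj
  have hmu : ∀ u, lam (g (π u)) = lam u := fun u =>
    le_antisymm (hle _ _ (hg _).le) (hle _ _ (hg _).ge)
  refine ⟨fun t => lam (g t), ⟨?_, ?_, ?_, ?_⟩, hmu⟩
  · rw [← hπ.map_zero, hmu, hlam.map_zero]
  · intro x y
    conv_lhs => rw [← hg x, ← hg y, ← hπ.map_add, hmu]
    exact hlam.map_add _ _
  · intro x y hxy
    exact hle _ _ (by rwa [hg, hg])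
  · intro f s hf hs
    have hzz : z + z ≤ z := by
      simpa using hquot (z + z) 0 (by simp [hπ.map_add, hπ.map_zero, hz])
    have hmono : Monotone fun n => g (f n) + z := fun a b hab => by
      have h₁ : g (f a) ≤ g (f b) + z := hquot _ _ (by rw [hg, hg]; exact hf hab)
      refine (CuSemigroup.add_le_add h₁ (le_refl z)).trans ?_
      rw [add_assoc]
      exact CuSemigroup.add_le_add le_rfl hzz
    obtain ⟨G, hG⟩ := CuSemigroup.exists_sup _ hmono
    have hπG := hπ.map_sup _ G hmono hG
    simp only [hπ.map_add, hg, hz, add_zero] at hπG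
    rw [hs.unique hπG, hmu, hlam.map_sup _ G hmono hG]
    simp only [hlam.map_add, hlz, add_zero]

theorem CuR1.map (hπ : IsCuMorphism π) (hsurj : Function.Surjective π)
    {z : S} (hz : π z = 0) (hquot : ∀ u v : S, π u ≤ π v → u ≤ v + z)
    {e : S} {r : ℝ} (h : CuR1 e r) : CuR1 (π e) r := by
  intro x y hxy
  obtain ⟨u, rfl⟩ := hsurj x
  obtain ⟨v, rfl⟩ := hsurj y
  have huv : u ≤ v + z := by
    refine h u (v + z) fun lam hlam => ?_
    rw [hlam.map_add v z]
    by_cases htop : lam z = ⊤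
    · simp [htop]
    have hzz : z + z ≤ 0 + z := hquot (z + z) 0 (by simp [hπ.map_add, hπ.map_zero, hz])
    have hlz : lam z = 0 := by
      have h₁ : lam z + lam z ≤ 0 + lam z := by
        simpa [hlam.map_add] using hlam.mono hzz
      exact le_antisymm ((ENNReal.add_le_add_iff_right htop).1 h₁) zero_le
    obtain ⟨mu, hmu, hmul⟩ := hlam.exists_descend hπ hsurj hz hquot hlz
    simpa [hmul, hlz] using hxy mu hmu
  simpa [hπ.map_add, hz] using hπ.mono huv

end CuQuotient

/-- The radius of comparison does not increase under passage to quotients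
(order-semigroup form of Proposition 3.8 (i)). -/
theorem cu_radius_quotient_le {S T : Type*} [CuSemigroup S] [CuSemigroup T]
    (π : S → T) (hπ : IsCuMorphism π) (hsurj : Function.Surjective π)
    (z : S) (hz : π z = 0) (hquot : ∀ u v : S, π u ≤ π v → u ≤ v + z)
    (e : S) (he : CuFull e) :
    CuFull (π e) ∧
      (∀ r : ℝ, 0 < r → CuR2' e r → CuR2' (π e) r) ∧
      cuRadius (π e) ≤ cuRadius e := by
  refine ⟨he.map hπ hsurj, fun r _ h => h.map hπ hsurj hz hquot, ?_⟩
  refine sInf_le_sInf ?_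
  rintro t ⟨r, hr, h, rfl⟩
  exact ⟨r, hr, h.map hπ hsurj hz hquot, rfl⟩
end

section
/- Let S be an abstract Cu-semigroup with a greatest element ω (so ω is full). Then the following are equivalent: (a) r_{(S,ω)} < ∞; (b) r_{(S,ω)} = 0; (c) for every y ∈ S, y = ω if and only if λ(y) = ∞ for every nonzero λ ∈ F(S). -/
open scoped ENNReal

/-- A nonzero functional is infinite at the greatest element. -/
theorem IsCuFunctional.apply_top {S : Type*} [CuSemigroup S] {ω : S} (hω : ∀ x : S, x ≤ ω)
    {lam : S → ℝ≥0∞} (h : IsCuFunctional lam) (hne : lam ≠ 0) : lam ω = ∞ := by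
  by_contra hfin
  apply hne
  have h2 : lam ω + lam ω ≤ lam ω + 0 := by
    rw [← h.map_add, add_zero]
    exact h.mono (hω _)
  have h0 : lam ω = 0 := le_antisymm ((ENNReal.add_le_add_iff_left hfin).1 h2) (zero_le)
  funext x
  exact le_antisymm ((h.mono (hω x)).trans_eq h0) (zero_le)

/-- With respect to the greatest element, condition (R1) does not depend on `r > 0`. -/
theorem cuR1_top_iff {S : Type*} [CuSemigroup S] {ω : S} (hω : ∀ x : S, x ≤ ω)
    {r : ℝ} (hr : 0 < r) :
    CuR1 ω r ↔ ∀ y : S, y = ω ↔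
      ∀ lam : S → ℝ≥0∞, IsCuFunctional lam → lam ≠ 0 → lam y = ∞ := by
  have hr' : ENNReal.ofReal r ≠ 0 := (ENNReal.ofReal_pos.2 hr).ne'
  constructor
  · refine fun h y => ⟨?_, fun hy => le_antisymm (hω y) (h ω y fun lam hl => ?_)⟩
    · rintro rfl lam hl hne
      exact hl.apply_top hω hne
    · by_cases hne : lam = 0
      · simp [hne]
      · simp [hy lam hl hne]
  · intro h x y hxy
    rw [(h y).2 fun lam hl hne => ?_]
    · exact hω x
    · have := hxy lam hl
      rwa [hl.apply_top hω hne, ENNReal.mul_top hr', add_top, top_le_iff] at this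

/-- If (R1) holds for all `r > 0`, then the radius of comparison vanishes. -/
theorem cuRadius_eq_zero {S : Type*} [CuSemigroup S] {e : S}
    (h : ∀ r : ℝ, 0 < r → CuR1 e r) : cuRadius e = 0 := by
  refine le_antisymm (ENNReal.le_of_forall_pos_le_add fun ε hε _ => ?_) (zero_le)
  rw [zero_add]
  exact sInf_le ⟨ε, hε, h ε hε, (ENNReal.ofReal_coe_nnreal).symm⟩

/-- If the radius of comparison is finite, then (R1) holds for some `r > 0`. -/
theorem exists_cuR1_of_cuRadius_lt_top {S : Type*} [CuSemigroup S] {e : S}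
    (h : cuRadius e < ∞) : ∃ r : ℝ, 0 < r ∧ CuR1 e r := by
  obtain ⟨_, ⟨r, hr, h1, _⟩, _⟩ := sInf_lt_iff.1 h
  exact ⟨r, hr, h1⟩

/-- For the greatest element ω of S: r_{(S,ω)} < ∞ iff r_{(S,ω)} = 0, iff
the elements of S with λ(y) = ∞ for every nonzero functional λ are exactly ω. -/
theorem cu_radius_top_trichotomy {S : Type*} [CuSemigroup S]
    (ω : S) (hω : ∀ x : S, x ≤ ω) :
    (cuRadius ω < ∞ ↔ cuRadius ω = 0) ∧
      (cuRadius ω = 0 ↔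
        ∀ y : S, y = ω ↔
          ∀ lam : S → ℝ≥0∞, IsCuFunctional lam → lam ≠ 0 → lam y = ∞) := by
  have of_lt_top (h : cuRadius ω < ∞) : ∀ y : S, y = ω ↔
      ∀ lam : S → ℝ≥0∞, IsCuFunctional lam → lam ≠ 0 → lam y = ∞ := by
    obtain ⟨r, hr, h1⟩ := exists_cuR1_of_cuRadius_lt_top h
    exact (cuR1_top_iff hω hr).1 h1
  have lt_top_of (h : cuRadius ω = 0) : cuRadius ω < ∞ := h ▸ ENNReal.zero_lt_top
  exact ⟨⟨fun h => cuRadius_eq_zero fun _ hr => (cuR1_top_iff hω hr).2 (of_lt_top h), lt_top_of⟩,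
    fun h => of_lt_top (lt_top_of h),
    fun h => cuRadius_eq_zero fun _ hr => (cuR1_top_iff hω hr).2 h⟩
end

section
/- Let S be an abstract Cu-semigroup and let e ∈ S be full, so that ω := sup_n n·e is the greatest element of S. If r_{(S,e)} < ∞, then r_{(S,ω)} = 0. -/
open scoped ENNReal

theorem IsCuFunctional.map_nsmul {S : Type*} [CuSemigroup S] {lam : S → ℝ≥0∞}
    (hl : IsCuFunctional lam) (n : ℕ) (x : S) : lam (n • x) = n * lam x := by
  induction n with
  | zero => simp [hl.map_zero]
  | succ k ih => rw [succ_nsmul, hl.map_add, ih, Nat.cast_succ, add_mul, one_mul]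

/-- If `(S, e)` satisfies (R1) for some `r`, and `ω` dominates all multiples of `e`, then
`(S, ω)` satisfies (R1) for every positive real. -/
theorem CuR1.of_nsmul_le {S : Type*} [CuSemigroup S] {e ω : S} {r s : ℝ}
    (hr : CuR1 e r) (hs : 0 < s) (hω : ∀ n : ℕ, n • e ≤ ω) : CuR1 ω s := by
  intro x y hxy
  refine hr x y fun lam hl => le_trans ?_ (hxy lam hl)
  obtain ⟨n, hn⟩ := exists_nat_ge (r / s)
  gcongr lam x + ?_
  calc ENNReal.ofReal r * lam e
      ≤ ENNReal.ofReal (s * n) * lam e := by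
        gcongr
        rw [mul_comm]
        exact (div_le_iff₀ hs).mp hn
    _ = ENNReal.ofReal s * lam (n • e) := by
        rw [ENNReal.ofReal_mul hs.le, ENNReal.ofReal_natCast, hl.map_nsmul, mul_assoc]
    _ ≤ ENNReal.ofReal s * lam ω := by
        gcongr
        exact hl.mono (hω n)

/-- If the radius of comparison relative to a full element e is finite, then
the radius of comparison relative to the greatest element ω = sup n•e is zero. -/
theorem cu_radius_top_eq_zero_of_radius_lt_top {S : Type*} [CuSemigroup S]
    (e ω : S) (hω : IsLUB (Set.range fun n : ℕ => n • e) ω)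
    (hfull : ∀ x : S, x ≤ ω) (h : cuRadius e < ∞) :
    cuRadius ω = 0 := by
  obtain ⟨_, ⟨r, _, hr, rfl⟩, _⟩ := sInf_lt_iff.mp h
  refine le_antisymm (ENNReal.le_of_forall_pos_le_add fun ε hε _ => ?_) zero_le
  rw [zero_add]
  exact sInf_le ⟨ε, hε, hr.of_nsmul_le hε fun n => hω.1 ⟨n, rfl⟩, by simp⟩
end

section
/- Let S be an abstract Cu-semigroup with the ω-comparison property: whenever x ∈ S and (y_i)_{i≥1} is a sequence in S with x ≤_s y_i for all i, then x ≤ Σ_{i=1}^∞ y_i. If (x_i)_{i≥1} is an increasing sequence in S and (y_i)_{i≥1} is a sequence in S with x_i ≤_s y_i for all i, then sup_n n·(sup_i x_i) ≤ Σ_{i=1}^∞ y_i; in particular, if sup_i x_i is full, then Σ_{i=1}^∞ y_i is the greatest element of S. -/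
open scoped ENNReal

instance CuSemigroup.toIsOrderedAddMonoid {S : Type*} [CuSemigroup S] : IsOrderedAddMonoid S where
  add_le_add_left _ _ h _ := CuSemigroup.add_le_add h le_rfl

theorem CuSemigroup.monotone_sum_range {S : Type*} [CuSemigroup S] (y : ℕ → S) :
    Monotone fun N => ∑ i ∈ Finset.range N, y i :=
  monotone_nat_of_le_succ fun N => by
    rw [Finset.sum_range_succ]
    exact le_add_of_nonneg_right (CuSemigroup.zero_le _)

theorem CuSemigroup.isLUB_nsmul {S : Type*} [CuSemigroup S] {x : ℕ → S} {a : S}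
    (hx : Monotone x) (ha : IsLUB (Set.range x) a) (n : ℕ) :
    IsLUB (Set.range fun j => n • x j) (n • a) := by
  induction n with
  | zero => simp
  | succ n ih =>
    simp only [succ_nsmul]
    exact CuSemigroup.add_isLUB (fun _ _ h => nsmul_le_nsmul_right (hx h) n) hx ih ha

/-- The witness of stable domination may be replaced by any multiple. -/
theorem CuSemigroup.succ_nsmul_le_of_dvd {S : Type*} [CuSemigroup S] {x y : S} {k K : ℕ}
    (hK : 0 < K) (hdvd : k ∣ K) (h : (k + 1) • x ≤ k • y) : (K + 1) • x ≤ K • y := by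
  obtain ⟨c, rfl⟩ := hdvd
  have hc : 0 < c := Nat.pos_of_mul_pos_left hK
  calc (k * c + 1) • x ≤ ((k + 1) * c) • x :=
        nsmul_le_nsmul_left (CuSemigroup.zero_le x) (by rw [add_mul]; omega)
    _ = c • (k + 1) • x := mul_nsmul _ _ _
    _ ≤ c • k • y := nsmul_le_nsmul_right h c
    _ = (k * c) • y := (mul_nsmul _ _ _).symm

/-- If `x` is stably dominated by each of `n` elements, then `n • x` is stably dominated by
their sum. -/
theorem CuSemigroup.nsmul_stable_le_sum {S : Type*} [CuSemigroup S] (x : S) (y : ℕ → S) (n : ℕ)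
    (h : ∀ i, ∃ k : ℕ, 0 < k ∧ (k + 1) • x ≤ k • y i) :
    ∃ k : ℕ, 0 < k ∧ (k + 1) • n • x ≤ k • ∑ i ∈ Finset.range n, y i := by
  choose k hk hle using h
  have hK : 0 < ∏ i ∈ Finset.range n, k i := Finset.prod_pos fun i _ => hk i
  refine ⟨_, hK, ?_⟩
  rw [Finset.smul_sum, nsmul_left_comm]
  simpa using Finset.sum_le_sum fun i (hi : i ∈ Finset.range n) =>
    CuSemigroup.succ_nsmul_le_of_dvd hK (Finset.dvd_prod_of_mem k hi) (hle i)

theorem CuSemigroup.sum_blocks_le {S : Type*} [CuSemigroup S] (y : ℕ → S) (j n N : ℕ) :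
    ∑ m ∈ Finset.range N, ∑ l ∈ Finset.range n, y (j + m * n + l) ≤
      ∑ i ∈ Finset.range (j + N * n), y i := by
  induction N with
  | zero => simpa using Finset.sum_nonneg fun i _ => CuSemigroup.zero_le (y i)
  | succ N ih =>
    rw [Finset.sum_range_succ, Nat.succ_mul, ← add_assoc, Finset.sum_range_add]
    exact add_le_add_left ih _

/-- If S has the ω-comparison property, increasing (x_i) with x_i ≤ₛ y_i give
sup_n n·(sup_i x_i) ≤ Σ y_i; in particular if sup x_i is full then Σ y_i is
the greatest element. -/
theorem cu_omegaComparison_sum {S : Type*} [CuSemigroup S]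
    (homega : ∀ (x : S) (y : ℕ → S) (s : S),
      (∀ i, ∃ k : ℕ, 0 < k ∧ (k + 1) • x ≤ k • y i) →
      IsLUB (Set.range fun N => ∑ i ∈ Finset.range N, y i) s → x ≤ s)
    (x y : ℕ → S) (hx : Monotone x)
    (hxy : ∀ i, ∃ k : ℕ, 0 < k ∧ (k + 1) • x i ≤ k • y i)
    (xsup : S) (hxsup : IsLUB (Set.range x) xsup)
    (s : S) (hsum : IsLUB (Set.range fun N => ∑ i ∈ Finset.range N, y i) s)
    (t : S) (ht : IsLUB (Set.range fun n : ℕ => n • xsup) t) :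
    t ≤ s ∧ (CuFull xsup → ∀ z : S, z ≤ s) := by
  have key (n j : ℕ) : n • x j ≤ s := by
    obtain ⟨s', hs'⟩ := CuSemigroup.exists_sup _ (CuSemigroup.monotone_sum_range
      fun m => ∑ l ∈ Finset.range n, y (j + m * n + l))
    refine (homega _ _ s' (fun m => ?_) hs').trans (hs'.2 ?_)
    · refine CuSemigroup.nsmul_stable_le_sum _ (fun l => y (j + m * n + l)) n fun l => ?_
      obtain ⟨k, hk, hle⟩ := hxy (j + m * n + l)
      exact ⟨k, hk, (nsmul_le_nsmul_right (hx (by omega)) _).trans hle⟩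
    · rintro _ ⟨N, rfl⟩
      exact (CuSemigroup.sum_blocks_le y j n N).trans (hsum.1 ⟨_, rfl⟩)
  have hts : t ≤ s := by
    refine ht.2 ?_
    rintro _ ⟨n, rfl⟩
    refine (CuSemigroup.isLUB_nsmul hx hxsup n).2 ?_
    rintro _ ⟨j, rfl⟩
    exact key n j
  exact ⟨hts, fun hfull z => (hfull t ht z).trans hts⟩
end

section
/- Let A be a C*-algebra such that every element of A is the norm-limit of a sequence of invertible elements of the unitization A~. Then for every x ∈ A there exists a sequence of unitaries (u_n) in A~ such that u_n*(x x*)u_n → x*x in norm. -/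
/-- In a unital C⋆-algebra, the unitary part of an invertible element `y` conjugates
`y * star y` to `star y * y`. -/
theorem IsUnit.exists_unitary_conj_mul_star_self {B : Type*} [CStarAlgebra B] {y : B}
    (hy : IsUnit y) :
    ∃ w : unitary B, star (w : B) * (y * star y) * w = star y * y := by
  let : PartialOrder B := CStarAlgebra.spectralOrder B
  have : StarOrderedRing B := CStarAlgebra.spectralOrderedRing B
  have habs : CFC.abs y * CFC.abs y = star y * y := CFC.abs_mul_abs y
  have hs : IsUnit (CFC.abs y) := by
    rw [← isUnit_pow_iff two_ne_zero, pow_two, habs]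
    exact hy.star.mul hy
  have hsa : star (CFC.abs y) = CFC.abs y := (CFC.abs_nonneg y).isSelfAdjoint
  obtain ⟨s, hs⟩ := hs
  rw [← hs] at habs hsa
  have hinv : star (↑s⁻¹ : B) = ↑s⁻¹ := by
    rw [← Units.coe_star_inv, show star s = s from Units.ext hsa]
  have hww : star (y * ↑s⁻¹) * (y * ↑s⁻¹) = 1 := by
    calc star (y * ↑s⁻¹) * (y * ↑s⁻¹) = ↑s⁻¹ * (star y * y) * ↑s⁻¹ := by
          rw [star_mul, hinv]; simp only [mul_assoc]
      _ = 1 := by rw [← habs]; simp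
  have hw : y * ↑s⁻¹ ∈ unitary B :=
    ⟨hww, (hy.mul s⁻¹.isUnit).mul_right_cancel (by rw [mul_assoc, hww, mul_one, one_mul])⟩
  refine ⟨⟨_, hw⟩, ?_⟩
  calc star (y * ↑s⁻¹) * (y * star y) * (y * ↑s⁻¹)
      = ↑s⁻¹ * (star y * y) * (star y * y) * ↑s⁻¹ := by
        rw [star_mul, hinv]; simp only [mul_assoc]
    _ = star y * y := by rw [← habs]; simp [mul_assoc]

open Filter Topology in
/-- If `x` is a limit of invertible elements of a unital C⋆-algebra, then `x * star x` and
`star x * x` are approximately unitarily equivalent. -/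
theorem exists_unitary_tendsto_conj_of_mem_closure_isUnit {B : Type*} [CStarAlgebra B] {x : B}
    (hx : x ∈ closure {y : B | IsUnit y}) :
    ∃ u : ℕ → unitary B,
      Tendsto (fun n => star (u n : B) * (x * star x) * u n) atTop (𝓝 (star x * x)) := by
  obtain ⟨y, hy, hyx⟩ := mem_closure_iff_seq_limit.mp hx
  choose u hu using fun n => (hy n).exists_unitary_conj_mul_star_self
  refine ⟨u, ?_⟩
  have hdiff : Tendsto (fun n => x * star x - y n * star (y n)) atTop (𝓝 0) := by
    simpa using (tendsto_const_nhds (x := x * star x)).sub (hyx.mul hyx.star)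
  have hconj : Tendsto
      (fun n => star (u n : B) * (x * star x - y n * star (y n)) * u n) atTop (𝓝 0) := by
    rw [tendsto_zero_iff_norm_tendsto_zero] at hdiff ⊢
    refine hdiff.congr fun n => ?_
    rw [CStarRing.norm_mul_coe_unitary, ← Unitary.coe_star, CStarRing.norm_coe_unitary_mul]
  have hsum := hconj.add (hyx.star.mul hyx)
  rw [zero_add] at hsum
  refine hsum.congr fun n => ?_
  rw [← hu n, mul_sub, sub_mul, sub_add_cancel]

/-- Paper Lemma 4.8: in a C*-algebra where every element is a norm-limit of
invertibles of the unitization, Murray–von Neumann equivalence implies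
approximate unitary equivalence: there are unitaries u_n of the unitization
with u_n* (x x*) u_n → x* x. -/
theorem mvn_implies_approx_unitary_equiv {A : Type*} [NonUnitalCStarAlgebra A]
    (h : ∀ a : A, (a : Unitization ℂ A) ∈ closure {u : Unitization ℂ A | IsUnit u})
    (x : A) :
    ∃ u : ℕ → unitary (Unitization ℂ A),
      Filter.Tendsto
        (fun n => star ((u n : Unitization ℂ A)) *
          ((x * star x : A) : Unitization ℂ A) * ((u n : Unitization ℂ A)))
        Filter.atTop (nhds (((star x * x : A) : Unitization ℂ A))) := by
  simpa using exists_unitary_tendsto_conj_of_mem_closure_isUnit (h x)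
end

section
/- Let A be a unital C*-algebra and let x ∈ A. Then the 2×2 matrix over A with x in the (1,1) entry and 0 in all other entries lies in the norm-closure of the set of invertible elements of the C*-algebra M₂(A) of 2×2 matrices over A. -/
/-- For a nonzero scalar `t`, the matrix with rows `(x, t)` and `(t, 0)` is invertible. -/
theorem isUnit_matrix_smul_one {K A : Type*} [Field K] [Ring A] [Algebra K A] (x : A) {t : K}
    (ht : t ≠ 0) :
    IsUnit (Matrix.of ![![x, t • 1], ![t • 1, 0]] : Matrix (Fin 2) (Fin 2) A) := by
  refine isUnit_iff_exists.mpr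
    ⟨Matrix.of ![![0, t⁻¹ • 1], ![t⁻¹ • 1, -((t⁻¹ * t⁻¹) • x)]], ?_, ?_⟩ <;>
  · ext i j
    fin_cases i <;> fin_cases j <;> simp [Matrix.mul_apply, Fin.sum_univ_two, smul_smul, ht]

/-- Key step of Lemma 4.7: for x in a unital C*-algebra A, the matrix
diag(x, 0) ∈ M₂(A) is a norm-limit of invertible elements of M₂(A). -/
theorem diag_mem_closure_invertibles {A : Type*} [CStarAlgebra A] (x : A) :
    (Matrix.of ![![x, 0], ![0, 0]] : Matrix (Fin 2) (Fin 2) A) ∈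
      closure {M : Matrix (Fin 2) (Fin 2) A | IsUnit M} := by
  have hcont : Continuous fun t : ℂ ↦
      (Matrix.of ![![x, t • 1], ![t • 1, 0]] : Matrix (Fin 2) (Fin 2) A) := by
    refine continuous_matrix fun i j ↦ ?_
    fin_cases i <;> fin_cases j <;> simp <;> fun_prop
  have hlim := (hcont.tendsto 0).mono_left (nhdsWithin_le_nhds (s := {0}ᶜ))
  simp only [zero_smul] at hlim
  exact mem_closure_of_tendsto hlim <|
    eventually_mem_nhdsWithin.mono fun t ht ↦ isUnit_matrix_smul_one x ht
end

section
/- Let A be a unital C*-algebra and let b, e ∈ A be positive elements with e ≤ 1. Then b ≤ 2(ebe + (1−e)b(1−e)). If moreover ‖b‖ ≤ 1, then b ≤ 2(e + (1−e)b(1−e)). -/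
/-- A positive contraction dominates its square. -/
theorem mul_self_le_self_of_nonneg_of_le_one {R : Type*} [Ring R] [StarRing R]
    [PartialOrder R] [StarOrderedRing R] {e : R} (he : 0 ≤ e) (he1 : e ≤ 1) :
    e * e ≤ e := by
  have h1e : 0 ≤ 1 - e := sub_nonneg.mpr he1
  have h := add_nonneg (conjugate_nonneg_of_nonneg h1e he) (conjugate_nonneg_of_nonneg he h1e)
  rw [← sub_nonneg]
  convert h using 1
  noncomm_ring

/-- Twice the pinching of a positive element by `e` and `1 - e` dominates that element. -/
theorem le_two_nsmul_conjugate_add_conjugate_one_sub {R : Type*} [Ring R] [StarRing R]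
    [PartialOrder R] [StarOrderedRing R] {b e : R} (hb : 0 ≤ b) (he : IsSelfAdjoint e) :
    b ≤ 2 • (e * b * e + (1 - e) * b * (1 - e)) := by
  have h := (he.sub ((IsSelfAdjoint.one R).sub he)).conjugate_nonneg hb
  rw [← sub_nonneg]
  convert h using 1
  noncomm_ring


/-- Key estimate of Lemma 4.4: for positive b, e with e ≤ 1 in a unital
C*-algebra, b ≤ 2(ebe + (1-e)b(1-e)); if moreover ‖b‖ ≤ 1 then
b ≤ 2(e + (1-e)b(1-e)). -/
theorem cstar_b_le_two_compression {A : Type*} [CStarAlgebra A]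
    [PartialOrder A] [StarOrderedRing A]
    (b e : A) (hb : 0 ≤ b) (he : 0 ≤ e) (he1 : e ≤ 1) :
    b ≤ 2 • (e * b * e + (1 - e) * b * (1 - e)) ∧
      (‖b‖ ≤ 1 → b ≤ 2 • (e + (1 - e) * b * (1 - e))) := by
  have h := le_two_nsmul_conjugate_add_conjugate_one_sub hb (IsSelfAdjoint.of_nonneg he)
  refine ⟨h, fun hb1 ↦ h.trans (nsmul_le_nsmul_right (add_le_add_left ?_ _) 2)⟩
  have hb1' : b ≤ 1 := (CStarAlgebra.norm_le_one_iff_of_nonneg b hb).mp hb1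
  calc e * b * e ≤ e * 1 * e := conjugate_le_conjugate_of_nonneg hb1' he
    _ = e * e := by rw [mul_one]
    _ ≤ e := mul_self_le_self_of_nonneg_of_le_one he he1
end
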